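/- Let Λ be a ring, e ∈ Λ an idempotent, and N a left Λ-module such that eN is finitely generated as a left module over the ring eΛe. Then there exist a natural number n and a homomorphism of left Λ-modules φ : (Λe)^n → N such that e · coker(φ) = 0, i.e. the cokernel of φ is killed by left multiplication by e. -/

import Mathlib

namespace Paper

variable {Λ : Type*} [Ring Λ]

/-- For an idempotent `e` of a ring `Λ`, the left ideal `Λe`, as a left `Λ`-submodule
of `Λ`; it consists of the elements `x` with `x * e = x`. -/
def Le (e : Λ) (he : e * e = e) : Submodule Λ Λ where
  carrier := {x | x * e = x}
  add_mem' := by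
    intro a b (ha : a * e = a) (hb : b * e = b)
    show (a + b) * e = a + b
    rw [add_mul, ha, hb]
  zero_mem' := by simp
  smul_mem' := by
    intro c x (hx : x * e = x)
    show c • x * e = c • x
    rw [smul_eq_mul, mul_assoc, hx]

/-- Let `Λ` be a ring, `e ∈ Λ` an idempotent, and `N` a left `Λ`-module such that `eN` is
finitely generated as a left module over the ring `eΛe` (expressed concretely: there is a
finite subset `s` of `eN` such that every element of `eN` is an `eΛe`-linear combination of
elements of `s`). Then there are an `n : ℕ` and a homomorphism of left `Λ`-modules
`φ : (Λe)^n → N` whose cokernel is killed by left multiplication by `e`, i.e.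
`e • m ∈ range φ` for every `m : N`. -/
theorem exists_hom_from_power_of_corner_fg (e : Λ) (he : e * e = e)
    (N : Type*) [AddCommGroup N] [Module Λ N]
    (hfg : ∃ s : Finset N, (∀ x ∈ s, e • x = x) ∧
      ∀ n : N, ∃ c : N → Λ, e • n = ∑ x ∈ s, (e * c x * e) • x) :
    ∃ (n : ℕ) (φ : (Fin n → ↥(Le e he)) →ₗ[Λ] N),
      ∀ m : N, e • m ∈ LinearMap.range φ := by
  obtain ⟨s, -, hs⟩ := hfg
  refine ⟨s.card, ∑ i, (LinearMap.toSpanSingleton Λ N (s.equivFin.symm i : N)) ∘ₗ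
    (Le e he).subtype ∘ₗ LinearMap.proj i, fun m => ?_⟩
  obtain ⟨c, hc⟩ := hs m
  refine ⟨fun i => ⟨e * c (s.equivFin.symm i) * e, ?_⟩, ?_⟩
  · change e * c _ * e * e = e * c _ * e
    rw [mul_assoc, he]
  · rw [hc, ← Finset.sum_coe_sort s (fun x => (e * c x * e) • x), LinearMap.sum_apply]
    exact s.equivFin.symm.sum_comp (fun x : s => (e * c x * e) • (x : N))

end Paper
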